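/- Let f : [0,∞) → ℝ be operator convex with f(0) ≤ 0. Then for every positive operator A on H, every strictly positive operator B on H, and every unit vector x ∈ H, ⟨Bx,x⟩ · f(⟨Ax,x⟩ / ⟨Bx,x⟩) ≤ ⟨g(A,B)x, x⟩, where g(A,B) = B^{1/2} f(B^{−1/2} A B^{−1/2}) B^{1/2} is the non-commutative perspective of f. -/

import Mathlib

open scoped InnerProductSpace

noncomputable section

/-- A continuous function `f : [0, ∞) → ℝ` is *operator convex* if for every complex Hilbert
space `K`, all selfadjoint operators `A, B` on `K` with spectra in `[0, ∞)` and every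
`λ ∈ [0, 1]` one has `f(λA + (1-λ)B) ≤ λ f(A) + (1-λ) f(B)` in the Loewner order, where
`f(A)` is given by the continuous functional calculus. -/
def OperatorConvexOn (f : ℝ → ℝ) : Prop :=
  ∀ (K : Type) [NormedAddCommGroup K] [InnerProductSpace ℂ K] [CompleteSpace K],
    ∀ A B : K →L[ℂ] K, IsSelfAdjoint A → IsSelfAdjoint B →
      spectrum ℝ A ⊆ Set.Ici (0 : ℝ) → spectrum ℝ B ⊆ Set.Ici (0 : ℝ) →
      ∀ lam : ℝ, lam ∈ Set.Icc (0 : ℝ) 1 →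
        cfc f (lam • A + (1 - lam) • B) ≤ lam • cfc f A + (1 - lam) • cfc f B

variable {H : Type} [NormedAddCommGroup H] [InnerProductSpace ℂ H] [CompleteSpace H]

/-- `R^{1/2}` via the continuous functional calculus. -/
def opSqrt (R : H →L[ℂ] H) : H →L[ℂ] H := cfc Real.sqrt R

/-- `R^{-1/2}` via the continuous functional calculus. -/
def opInvSqrt (R : H →L[ℂ] H) : H →L[ℂ] H := cfc (fun t : ℝ => (Real.sqrt t)⁻¹) R

/-- The non-commutative perspective `g(L, R) = R^{1/2} f(R^{-1/2} L R^{-1/2}) R^{1/2}`. -/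
def persp (f : ℝ → ℝ) (L R : H →L[ℂ] H) : H →L[ℂ] H :=
  opSqrt R * cfc f (opInvSqrt R * L * opInvSqrt R) * opSqrt R

open ContinuousLinearMap in
theorem reApplyInnerSelf_mono {E : Type*} [NormedAddCommGroup E] [InnerProductSpace ℂ E]
    {S T : E →L[ℂ] E} (h : S ≤ T) (x : E) :
    S.reApplyInnerSelf x ≤ T.reApplyInnerSelf x := by
  have := ((le_def S T).mp h).2 x
  simpa [reApplyInnerSelf_apply, inner_sub_left] using this

theorem IsSelfAdjoint.reApplyInnerSelf_conj {S : H →L[ℂ] H} (hS : IsSelfAdjoint S)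
    (T : H →L[ℂ] H) (x : H) :
    (S * T * S).reApplyInnerSelf x = T.reApplyInnerSelf (S x) := by
  simp only [ContinuousLinearMap.reApplyInnerSelf_apply, mul_apply_eq_comp]
  rw [← ContinuousLinearMap.adjoint_inner_right S,
    ContinuousLinearMap.isSelfAdjoint_iff'.mp hS]

theorem OperatorConvexOn.convexOn {f : ℝ → ℝ} (hf : OperatorConvexOn f) :
    ConvexOn ℝ (Set.Ici (0 : ℝ)) f := by
  refine ⟨convex_Ici 0, fun a ha b hb p q hp hq hpq => ?_⟩
  obtain rfl : q = 1 - p := by linarith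
  have hspec : ∀ r : ℝ, 0 ≤ r →
      spectrum ℝ (algebraMap ℝ (ℂ →L[ℂ] ℂ) r) ⊆ Set.Ici (0 : ℝ) := fun r hr => by
    rw [spectrum.scalar_eq]
    simpa using hr
  have h := hf ℂ (algebraMap ℝ _ a) (algebraMap ℝ _ b) (cfc_predicate_algebraMap a)
    (cfc_predicate_algebraMap b) (hspec a ha) (hspec b hb) p ⟨hp, by linarith⟩
  have hcomb : p • algebraMap ℝ (ℂ →L[ℂ] ℂ) a + (1 - p) • algebraMap ℝ (ℂ →L[ℂ] ℂ) b =
      algebraMap ℝ (ℂ →L[ℂ] ℂ) (p * a + (1 - p) * b) := by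
    rw [map_add, map_mul, map_mul]
    simp only [Algebra.algebraMap_eq_smul_one, smul_mul_assoc, one_mul]
  rw [hcomb, cfc_algebraMap, cfc_algebraMap, cfc_algebraMap] at h
  simpa [ContinuousLinearMap.reApplyInnerSelf_apply, Algebra.algebraMap_eq_smul_one] using
    reApplyInnerSelf_mono h 1

/-- Jensen's inequality for the quadratic form of a positive operator. -/
theorem ConvexOn.mul_le_reApplyInnerSelf_cfc {f : ℝ → ℝ}
    (hf : ConvexOn ℝ (Set.Ici (0 : ℝ)) f) (hf_cont : ContinuousOn f (Set.Ici (0 : ℝ)))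
    {T : H →L[ℂ] H} (hT : 0 ≤ T) {y : H} (hy : y ≠ 0) :
    ‖y‖ ^ 2 * f (T.reApplyInnerSelf y / ‖y‖ ^ 2) ≤ (cfc f T).reApplyInnerSelf y := by
  have hn : 0 < ‖y‖ ^ 2 := by positivity
  have hTy : 0 ≤ T.reApplyInnerSelf y :=
    ((ContinuousLinearMap.nonneg_iff_isPositive T).mp hT).2 y
  have hsp : spectrum ℝ T ⊆ Set.Ici (0 : ℝ) := fun t ht => spectrum_nonneg_of_nonneg hT ht
  rw [mul_comm, ← le_div_iff₀ hn]
  refine le_of_forall_lt fun a ha => ?_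
  obtain ⟨a', haa', ha'⟩ := exists_between ha
  obtain ⟨c, c', hle, heq⟩ := hf.exists_affine_le_of_lt_real (div_nonneg hTy hn.le) ha'
    isClosed_Ici hf_cont.lowerSemicontinuousOn
  refine haa'.trans_le ?_
  have hmono : cfc (fun t : ℝ => c * t + c') T ≤ cfc f T :=
    cfc_mono (fun t ht => hle t (hsp ht)) (by fun_prop) (hf_cont.mono hsp)
  rw [cfc_add_const c' (fun t => c * t) T, cfc_const_mul c (fun t => t) T, cfc_id' ℝ T] at hmono
  have hval : (c • T + algebraMap ℝ (H →L[ℂ] H) c').reApplyInnerSelf y =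
      c * T.reApplyInnerSelf y + c' * ‖y‖ ^ 2 := by
    simp [ContinuousLinearMap.reApplyInnerSelf_apply, Algebra.algebraMap_eq_smul_one,
      inner_add_left, inner_smul_left_eq_smul, ← Complex.ofReal_pow]
  rw [le_div_iff₀ hn, ← heq]
  refine le_trans (le_of_eq ?_) (hval ▸ reApplyInnerSelf_mono hmono y)
  field_simp

theorem opSqrt_isSelfAdjoint (R : H →L[ℂ] H) : IsSelfAdjoint (opSqrt R) :=
  cfc_predicate _ R

theorem opInvSqrt_isSelfAdjoint (R : H →L[ℂ] H) : IsSelfAdjoint (opInvSqrt R) :=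
  cfc_predicate _ R

theorem opSqrt_mul_self {R : H →L[ℂ] H} (hR : 0 ≤ R) : opSqrt R * opSqrt R = R := by
  rw [opSqrt, ← cfc_mul Real.sqrt Real.sqrt R]
  conv_rhs => rw [← cfc_id' ℝ R]
  exact cfc_congr fun t ht => Real.mul_self_sqrt (spectrum_nonneg_of_nonneg hR ht)

theorem opInvSqrt_mul_opSqrt {R : H →L[ℂ] H} (hR : 0 ≤ R) (hRu : IsUnit R) :
    opInvSqrt R * opSqrt R = 1 := by
  have hpos : ∀ t ∈ spectrum ℝ R, Real.sqrt t ≠ 0 := fun t ht =>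
    (Real.sqrt_pos.mpr ((spectrum_nonneg_of_nonneg hR ht).lt_of_ne'
      (spectrum.ne_zero_of_mem_of_unit (a := hRu.unit) ht))).ne'
  rw [opInvSqrt, opSqrt, ← cfc_mul (fun t : ℝ => (Real.sqrt t)⁻¹) Real.sqrt R
    (Real.continuous_sqrt.continuousOn.inv₀ hpos), ← cfc_one ℝ R]
  exact cfc_congr fun t ht => inv_mul_cancel₀ (hpos t ht)

/-- For an operator convex `f` with `f(0) ≤ 0`, a positive operator `A`, a strictly
positive operator `B` and a unit vector `x`:
`⟨Bx, x⟩ f(⟨Ax, x⟩ / ⟨Bx, x⟩) ≤ ⟨g(A, B) x, x⟩`. -/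
theorem stmt_8 (f : ℝ → ℝ) (hf_cont : ContinuousOn f (Set.Ici (0 : ℝ)))
    (hf : OperatorConvexOn f) (hf0 : f 0 ≤ 0)
    (A B : H →L[ℂ] H) (hA : 0 ≤ A) (hB : 0 ≤ B) (hBu : IsUnit B)
    (x : H) (hx : ‖x‖ = 1) :
    B.reApplyInnerSelf x * f (A.reApplyInnerSelf x / B.reApplyInnerSelf x) ≤
      (persp f A B).reApplyInnerSelf x := by
  have hinv : opInvSqrt B (opSqrt B x) = x := by
    simpa using congrArg (fun S : H →L[ℂ] H => S x) (opInvSqrt_mul_opSqrt hB hBu)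
  have hy : opSqrt B x ≠ 0 := fun h => by
    rw [h, map_zero] at hinv
    simp [← hinv] at hx
  have hBx : B.reApplyInnerSelf x = ‖opSqrt B x‖ ^ 2 := by
    have h := (opSqrt_isSelfAdjoint B).reApplyInnerSelf_conj 1 x
    rw [mul_one, opSqrt_mul_self hB] at h
    rw [h, ContinuousLinearMap.reApplyInnerSelf_apply, one_apply_eq_self,
      inner_self_eq_norm_sq]
  have hAx : A.reApplyInnerSelf x =
      (opInvSqrt B * A * opInvSqrt B).reApplyInnerSelf (opSqrt B x) := by
    rw [(opInvSqrt_isSelfAdjoint B).reApplyInnerSelf_conj, hinv]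
  rw [hBx, hAx, persp, (opSqrt_isSelfAdjoint B).reApplyInnerSelf_conj]
  exact hf.convexOn.mul_le_reApplyInnerSelf_cfc hf_cont
    ((opInvSqrt_isSelfAdjoint B).conjugate_nonneg hA) hy
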